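/- Let z_{-N},...,z_N be distinct nonzero complex numbers and λ ∈ ℂ with λ ≠ 0, such that z_i ≠ λ z_j for all i,j. Define t_{ij} = (z_i + λ z_j)/(z_i - λ z_j), f_m^2 = Π_{k≠m} ((z_m - λ z_k)(z_k - λ z_m))/(λ (z_m - z_k)(z_k - z_m)), and u_m = Σ_{k≠m} [2(z_m+z_k)/(z_m-z_k) + (z_k+λz_m)/(z_k-λz_m) - (z_m+λz_k)/(z_m-λz_k)]. Then for all indices i, j: Σ_{m=-N}^{N} t_{im} f_m^2 t_{mj} (t_{mj} - t_{im} + u_m) = Σ_{m=-N}^{N} f_m^2 (t_{im} - t_{mj}). -/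

import Mathlib

open Finset

open Polynomial in
/-- Logarithmic derivative of a product of polynomials. -/
lemma aux_logder {ι : Type*} [DecidableEq ι] (s : Finset ι) (F : ι → ℂ[X]) (x : ℂ)
    (h : ∀ k ∈ s, (F k).eval x ≠ 0) :
    (derivative (∏ k ∈ s, F k)).eval x
      = (∏ k ∈ s, F k).eval x * ∑ k ∈ s, (derivative (F k)).eval x / (F k).eval x := by
  induction s using Finset.induction_on with
  | empty => simp
  | insert a s ha ih =>
    have h1 := ih (fun k hk => h k (mem_insert_of_mem hk))
    have h2 := h a (mem_insert_self _ _)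
    rw [prod_insert ha, sum_insert ha, derivative_mul]
    simp only [eval_add, eval_mul]
    rw [h1]
    field_simp

open Polynomial in
/-- The sum of the residues of `S / Q ^ 2` vanishes if `deg S + 1 < deg Q ^ 2`. -/
lemma aux_residues {ι : Type*} [Fintype ι] [DecidableEq ι] (z : ι → ℂ)
    (hinj : Function.Injective z) (S : ℂ[X])
    (hS : S.degree < ((2 * Fintype.card ι - 1 : ℕ) : WithBot ℕ))
    (Q : ι → ℂ[X]) (hQ : ∀ m, Q m = ∏ k ∈ univ.erase m, (X - C (z k))) :
    ∑ m, ((derivative S).eval (z m) * (Q m).eval (z m)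
      - 2 * S.eval (z m) * (derivative (Q m)).eval (z m)) / (Q m).eval (z m) ^ 3 = 0 := by
  set r : ι → ℂ := fun m => ((derivative S).eval (z m) * (Q m).eval (z m)
      - 2 * S.eval (z m) * (derivative (Q m)).eval (z m)) / (Q m).eval (z m) ^ 3 with hr
  set a : ι → ℂ := fun m => S.eval (z m) / (Q m).eval (z m) ^ 2 with ha
  have hq : ∀ m, (Q m).eval (z m) ≠ 0 := by
    intro m
    rw [hQ, eval_prod, prod_ne_zero_iff]
    intro k hk
    simp only [eval_sub, eval_X, eval_C]
    exact sub_ne_zero.mpr (fun h => (mem_erase.mp hk).1 (hinj h).symm)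
  have hq0 : ∀ m l, l ≠ m → (Q l).eval (z m) = 0 := by
    intro m l hl
    rw [hQ, eval_prod]
    exact prod_eq_zero (mem_erase.mpr ⟨hl.symm, mem_univ m⟩) (by simp)
  have hmon : ∀ m, (Q m).Monic := by
    intro m; rw [hQ]; exact monic_prod_of_monic _ _ (fun k _ => monic_X_sub_C _)
  have hcard : ∀ m : ι, 1 ≤ Fintype.card ι := fun m => Fintype.card_pos_iff.mpr ⟨m⟩
  have hdeg : ∀ m, (Q m).natDegree = Fintype.card ι - 1 := by
    intro m
    rw [hQ, natDegree_prod_of_monic _ _ (fun k _ => monic_X_sub_C _)]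
    simp [card_erase_of_mem]
  set T : ℂ[X] := ∑ m, (C (a m) * (Q m) ^ 2 + C (r m) * ((X - C (z m)) * (Q m) ^ 2)) with hT
  have hdeg2 : ∀ m, ((Q m) ^ 2).natDegree = 2 * (Fintype.card ι - 1) := by
    intro m; rw [(hmon m).natDegree_pow, hdeg]
  have hdeg3 : ∀ m, ((X - C (z m)) * (Q m) ^ 2).natDegree = 2 * Fintype.card ι - 1 := by
    intro m
    rw [(monic_X_sub_C _).natDegree_mul ((hmon m).pow 2), hdeg2, natDegree_X_sub_C]
    have := hcard m; omega
  have hTc : T.coeff (2 * Fintype.card ι - 1) = ∑ m, r m := by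
    rw [hT, finsetSum_coeff]
    refine sum_congr rfl (fun m _ => ?_)
    have h1 : ((Q m) ^ 2).coeff (2 * Fintype.card ι - 1) = 0 := by
      apply coeff_eq_zero_of_natDegree_lt
      rw [hdeg2]; have := hcard m; omega
    have h2 : ((X - C (z m)) * (Q m) ^ 2).coeff (2 * Fintype.card ι - 1) = 1 := by
      rw [← hdeg3 m]
      exact ((monic_X_sub_C _).mul ((hmon m).pow 2))
    rw [coeff_add, coeff_C_mul, coeff_C_mul, h1, h2]; ring
  have hTd : T.degree < ((2 * Fintype.card ι : ℕ) : WithBot ℕ) := by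
    rw [hT]
    refine (degree_sum_le _ _).trans_lt ?_
    rw [Finset.sup_lt_iff (WithBot.bot_lt_coe _)]
    intro m _
    have := hcard m
    refine (degree_add_le _ _).trans_lt (max_lt ?_ ?_)
    · refine degree_le_natDegree.trans_lt (Nat.cast_lt.mpr ((natDegree_C_mul_le _ _).trans_lt ?_))
      rw [hdeg2]; omega
    · refine degree_le_natDegree.trans_lt (Nat.cast_lt.mpr ((natDegree_C_mul_le _ _).trans_lt ?_))
      rw [hdeg3]; omega
  have hTe : ∀ m, T.eval (z m) = S.eval (z m) := by
    intro m
    rw [hT, eval_finsetSum, Finset.sum_eq_single m]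
    · have := hq m
      simp [ha]; field_simp
    · intro l _ hl
      simp [hq0 m l hl]
    · simp
  have hTe' : ∀ m, (derivative T).eval (z m) = (derivative S).eval (z m) := by
    intro m
    rw [hT, derivative_sum, eval_finsetSum, Finset.sum_eq_single m]
    · have := hq m
      simp [ha, hr, derivative_pow]; field_simp; ring
    · intro l _ hl
      simp [hq0 m l hl, derivative_pow]
    · simp
  have hD : S - T = 0 := by
    by_contra hne
    have hdvd : ∏ m, (X - C (z m)) ^ 2 ∣ S - T := by
      apply Finset.prod_dvd_of_coprime
      · intro m _ l _ hml
        exact (pairwise_coprime_X_sub_C hinj hml).pow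
      · intro m _
        have h1 : 1 < (S - T).rootMultiplicity (z m) := by
          rw [one_lt_rootMultiplicity_iff_isRoot hne]
          simp [IsRoot, hTe, hTe']
        exact (pow_dvd_pow _ h1).trans (pow_rootMultiplicity_dvd _ _)
    have h2 := degree_le_of_dvd hdvd hne
    rw [degree_prod] at h2
    simp only [degree_pow, degree_X_sub_C] at h2
    have h3 : (S - T).degree < ((2 * Fintype.card ι : ℕ) : WithBot ℕ) := by
      refine (degree_sub_le _ _).trans_lt (max_lt (hS.trans_le ?_) hTd)
      exact_mod_cast (by omega)
    have h4 := h2.trans_lt h3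
    simp [mul_comm] at h4
  rw [← hTc, ← sub_eq_zero.mp hD]
  exact coeff_eq_zero_of_degree_lt hS

/-- The algebra for a single summand of `u`. -/
lemma aux_u (x y l : ℂ) (h1 : x - y ≠ 0) (h2 : x - l * y ≠ 0) (h3 : y - l * x ≠ 0) :
    2 * (x + y) / (x - y) + (y + l * x) / (y - l * x) - (x + l * y) / (x - l * y)
    = -2 * x * (((y - l * x) - l * (x - l * y)) / ((x - l * y) * (y - l * x))
      - 2 * (1 / (x - y))) := by
  rw [div_add_div _ _ h1 h3, div_sub_div _ _ (mul_ne_zero h1 h3) h2, mul_one_div,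
    div_sub_div _ _ (mul_ne_zero h2 h3) h1, mul_div_assoc',
    div_eq_div_iff (mul_ne_zero (mul_ne_zero h1 h3) h2) (mul_ne_zero (mul_ne_zero h2 h3) h1)]
  ring

/-- The algebra for a single residue. -/
lemma aux_term (a b x l w w' q q' b0 b1 κ u f S S' : ℂ) (hx : x ≠ 0) (hκ : κ ≠ 0) (hl : 1 - l ≠ 0)
    (hq : q ≠ 0) (hw : w ≠ 0) (h1 : x - l * b ≠ 0) (h2 : a - l * x ≠ 0)
    (hb0 : b0 * ((x - l * b) * (a - l * x)) = (x - l * x) ^ 2 * w)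
    (hb1 : b1 * ((x - l * b) * (a - l * x)) + b0 * ((a - l * x) - l * (x - l * b))
      = (x - l * x) ^ 2 * w' + w * ((x - l * x) - l * (x - l * x)))
    (hf : f = w / (κ * q ^ 2)) (hu : u = -2 * x * (w' / w - 2 * (q' / q)))
    (hS : x * S = (a + l * x) * (x + l * b) * b0)
    (hS' : S + x * S' = (l * (x + l * b) + (a + l * x)) * b0 + (a + l * x) * (x + l * b) * b1) :
    -2 / (κ * (1 - l) ^ 2) * ((S' * q - 2 * S * q') / q ^ 3)
     = (a + l * x) / (a - l * x) * f * ((x + l * b) / (x - l * b)) *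
      ((x + l * b) / (x - l * b) - (a + l * x) / (a - l * x) + u)
      - f * ((a + l * x) / (a - l * x) - (x + l * b) / (x - l * b)) := by
  have e0 : b0 = (x - l * x) ^ 2 * w / ((x - l * b) * (a - l * x)) := by
    rw [eq_div_iff (mul_ne_zero h1 h2)]; exact hb0
  have e1 : b1 = ((x - l * x) ^ 2 * w' + w * ((x - l * x) - l * (x - l * x))
      - b0 * ((a - l * x) - l * (x - l * b))) / ((x - l * b) * (a - l * x)) := by
    rw [eq_div_iff (mul_ne_zero h1 h2)]; linear_combination hb1
  have eS : S = (a + l * x) * (x + l * b) * b0 / x := by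
    rw [eq_div_iff hx]; linear_combination hS
  have eS' : S' = ((l * (x + l * b) + (a + l * x)) * b0 + (a + l * x) * (x + l * b) * b1 - S)
      / x := by
    rw [eq_div_iff hx]; linear_combination hS'
  rw [eS', eS, e1, e0, hf, hu]
  field_simp
  ring

open Polynomial in
theorem aux_main (N : ℕ) (z : Fin (2 * N + 1) → ℂ) (lam : ℂ)
    (hinj : Function.Injective z) (hz : ∀ i, z i ≠ 0) (hlam : lam ≠ 0)
    (hzl : ∀ i j, z i ≠ lam * z j)
    (t : Fin (2 * N + 1) → Fin (2 * N + 1) → ℂ)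
    (ht : ∀ i j, t i j = (z i + lam * z j) / (z i - lam * z j))
    (f2 : Fin (2 * N + 1) → ℂ)
    (hf2 : ∀ m, f2 m = ∏ k ∈ univ.erase m,
      ((z m - lam * z k) * (z k - lam * z m)) / (lam * (z m - z k) * (z k - z m)))
    (u : Fin (2 * N + 1) → ℂ)
    (hu : ∀ m, u m = ∑ k ∈ univ.erase m,
      (2 * (z m + z k) / (z m - z k) + (z k + lam * z m) / (z k - lam * z m)
        - (z m + lam * z k) / (z m - lam * z k))) :
    ∀ i j, ∑ m, t i m * f2 m * t m j * (t m j - t i m + u m)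
      = ∑ m, f2 m * (t i m - t m j) := by
  intro i j
  have hn : ∀ m : Fin (2 * N + 1), (univ.erase m).card = 2 * N := by
    intro m; simp [card_erase_of_mem]
  have hpc : ∀ (c : ℂ) (m : Fin (2 * N + 1)), c ^ (2 * N) = ∏ _k ∈ univ.erase m, c := by
    intro c m; rw [prod_const, hn]
  have hl1 : 1 - lam ≠ 0 := by
    intro h
    exact hzl i i (by linear_combination (z i) * h)
  have hd : ∀ a b, z a - lam * z b ≠ 0 := fun a b => sub_ne_zero.mpr (hzl a b)
  have hne : ∀ m, ∀ k ∈ univ.erase m, z m - z k ≠ 0 := fun m k hk =>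
    sub_ne_zero.mpr (fun h => (mem_erase.mp hk).1 (hinj h).symm)
  set κ : ℂ := (-lam) ^ (2 * N) with hκ
  have hκ0 : κ ≠ 0 := pow_ne_zero _ (neg_ne_zero.mpr hlam)
  let Q : Fin (2 * N + 1) → ℂ[X] := fun m => ∏ k ∈ univ.erase m, (X - C (z k))
  let Qf : ℂ[X] := ∏ k, (X - C (z k))
  let U : Fin (2 * N + 1) → ℂ[X] := fun k => X - C (lam * z k)
  let V : Fin (2 * N + 1) → ℂ[X] := fun k => C (z k) - C lam * X
  let W : Fin (2 * N + 1) → ℂ[X] := fun m => ∏ k ∈ univ.erase m, (U k * V k)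
  let B : ℂ[X] := (∏ k ∈ univ.erase j, U k) * ∏ k ∈ univ.erase i, V k
  let M : ℂ[X] := (X + C (z i / lam)) * (X + C (lam * z j)) *
    ((∏ k ∈ univ.erase j, U k) * ∏ k ∈ univ.erase i, (X - C (z k / lam)))
  have hQQ : ∀ m, Qf = (X - C (z m)) * Q m := fun m =>
    (mul_prod_erase univ (fun k => X - C (z k)) (mem_univ m)).symm
  have hBW : ∀ m, B * (U j * V i) = (U m * V m) * W m := by
    intro m
    have e1 := mul_prod_erase univ U (mem_univ j)
    have e2 := mul_prod_erase univ V (mem_univ i)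
    have e3 := mul_prod_erase univ (fun k => U k * V k) (mem_univ m)
    rw [prod_mul_distrib (s := univ), ← e1, ← e2] at e3
    simp only [B, W]
    linear_combination -e3
  have hV : ∀ k, V k = C (-lam) * (X - C (z k / lam)) := by
    intro k
    simp only [V]
    rw [mul_sub, ← C_mul, show -lam * (z k / lam) = -z k by field_simp]
    simp; ring
  have hMP : C (lam * κ) * M = (C (z i) + C lam * X) * (X + C (lam * z j)) * B := by
    have h1 : ∏ k ∈ univ.erase i, V k
        = C κ * ∏ k ∈ univ.erase i, (X - C (z k / lam)) := by
      rw [prod_congr rfl (fun k _ => hV k), prod_mul_distrib, prod_const, hn, hκ, C_pow]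
    have h2 : C (z i) + C lam * X = C lam * (X + C (z i / lam)) := by
      rw [mul_add, ← C_mul, mul_div_cancel₀ _ hlam]; ring
    simp only [M, B]
    rw [h1, h2, C_mul]; ring
  have hmU : (∏ k ∈ univ.erase j, U k).Monic :=
    monic_prod_of_monic _ _ (fun k _ => monic_X_sub_C _)
  have hmV : (∏ k ∈ univ.erase i, (X - C (z k / lam))).Monic :=
    monic_prod_of_monic _ _ (fun k _ => monic_X_sub_C _)
  have hmQ : Qf.Monic := monic_prod_of_monic _ _ (fun k _ => monic_X_sub_C _)
  have hmL : ((X + C (z i / lam)) * (X + C (lam * z j))).Monic :=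
    (monic_X_add_C _).mul (monic_X_add_C _)
  have hmM : M.Monic := hmL.mul (hmU.mul hmV)
  have hdM : M.natDegree = 4 * N + 2 := by
    simp only [M]
    rw [hmL.natDegree_mul (hmU.mul hmV), hmU.natDegree_mul hmV,
      (monic_X_add_C _).natDegree_mul (monic_X_add_C _),
      natDegree_prod_of_monic _ _ (fun k _ => monic_X_sub_C _),
      natDegree_prod_of_monic _ _ (fun k _ => monic_X_sub_C _)]
    simp only [natDegree_X_add_C, U, natDegree_X_sub_C, sum_const, hn, smul_eq_mul]
    ring
  have hdQ : (Qf ^ 2).natDegree = 4 * N + 2 := by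
    rw [hmQ.natDegree_pow]
    simp only [Qf]
    rw [natDegree_prod_of_monic _ _ (fun k _ => monic_X_sub_C _)]
    simp only [natDegree_X_sub_C, sum_const, card_univ, Fintype.card_fin, smul_eq_mul]
    ring
  have hdlt : (M - Qf ^ 2).degree < ((4 * N + 2 : ℕ) : WithBot ℕ) := by
    have := degree_sub_lt_left (p := M) (q := Qf ^ 2)
      (by rw [degree_eq_natDegree hmM.ne_zero, degree_eq_natDegree (hmQ.pow 2).ne_zero, hdM, hdQ])
      hmM.ne_zero (by rw [hmM.leadingCoeff, (hmQ.pow 2).leadingCoeff])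
    rwa [degree_eq_natDegree hmM.ne_zero, hdM] at this
  have hroot : (M - Qf ^ 2).eval 0 = 0 := by
    have e1 := mul_prod_erase univ (fun k => - z k) (mem_univ j)
    have e2 := mul_prod_erase univ (fun k => - z k) (mem_univ i)
    have g1 : ∏ k ∈ univ.erase j, (-(lam * z k))
        = lam ^ (2 * N) * ∏ k ∈ univ.erase j, (- z k) := by
      rw [hpc lam j, ← prod_mul_distrib]
      exact prod_congr rfl (fun k _ => by ring)
    have g2 : ∏ k ∈ univ.erase i, (-(z k / lam))
        = (∏ k ∈ univ.erase i, (- z k)) / lam ^ (2 * N) := by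
      rw [hpc lam i, ← prod_div_distrib]
      exact prod_congr rfl (fun k _ => by ring)
    simp only [M, Qf, U, eval_sub, eval_mul, eval_pow, eval_prod, eval_add, eval_X, eval_C,
      zero_sub, zero_add]
    rw [g1, g2, sq]
    nth_rewrite 1 [← e1]
    rw [← e2]
    field_simp
    ring
  obtain ⟨S0, hS0⟩ : X ∣ M - Qf ^ 2 := by
    rw [X_dvd_iff, coeff_zero_eq_eval_zero]; exact hroot
  have hS0d : S0.degree < ((2 * Fintype.card (Fin (2 * N + 1)) - 1 : ℕ) : WithBot ℕ) := by
    rw [Fintype.card_fin, show 2 * (2 * N + 1) - 1 = 4 * N + 1 by omega]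
    by_cases h0 : S0 = 0
    · rw [h0, degree_zero]; exact WithBot.bot_lt_coe _
    · rw [hS0, degree_mul, degree_X, degree_eq_natDegree h0] at hdlt
      rw [degree_eq_natDegree h0]
      have h5 : 1 + S0.natDegree < 4 * N + 2 := by exact_mod_cast hdlt
      exact_mod_cast (by omega : S0.natDegree < 4 * N + 1)
  let S : ℂ[X] := C (lam * κ) * S0
  have hSd : S.degree < ((2 * Fintype.card (Fin (2 * N + 1)) - 1 : ℕ) : WithBot ℕ) := by
    simp only [S]
    rw [degree_C_mul (mul_ne_zero hlam hκ0)]; exact hS0d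
  have hSP : X * S = (C (z i) + C lam * X) * (X + C (lam * z j)) * B
      - C (lam * κ) * Qf ^ 2 := by
    rw [← hMP]
    simp only [S]
    linear_combination -(C (lam * κ)) * hS0
  have key := aux_residues z hinj S hSd Q (fun m => rfl)
  rw [← sub_eq_zero, ← sum_sub_distrib]
  rw [← mul_zero (-2 / (κ * (1 - lam) ^ 2)), ← key, mul_sum]
  refine sum_congr rfl (fun m _ => ?_)
  rw [ht i m, ht m j]
  have hq : (Q m).eval (z m) ≠ 0 := by
    simp only [Q, eval_prod, eval_sub, eval_X, eval_C]
    exact prod_ne_zero_iff.mpr (hne m)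
  have hw : (W m).eval (z m) ≠ 0 := by
    simp only [W, U, V, eval_prod, eval_sub, eval_X, eval_C, eval_mul]
    exact prod_ne_zero_iff.mpr (fun k _ => mul_ne_zero (hd m k) (hd k m))
  symm
  refine aux_term (z i) (z j) (z m) lam ((W m).eval (z m)) ((derivative (W m)).eval (z m))
    ((Q m).eval (z m)) ((derivative (Q m)).eval (z m)) (B.eval (z m))
    ((derivative B).eval (z m)) κ (u m) (f2 m) (S.eval (z m)) ((derivative S).eval (z m))
    (hz m) hκ0 hl1 hq hw (hd m j) (hd i m) ?_ ?_ ?_ ?_ ?_ ?_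
  · have := congrArg (eval (z m)) (hBW m)
    simp only [U, V, eval_mul, eval_sub, eval_X, eval_C] at this
    linear_combination this
  · have := congrArg (fun p => eval (z m) (derivative p)) (hBW m)
    simp only [U, V, derivative_mul, derivative_sub, derivative_X, derivative_C, eval_mul,
      eval_sub, eval_add, eval_X, eval_C, eval_one, eval_zero] at this
    linear_combination this
  · rw [hf2]
    simp only [W, Q, U, V, eval_prod, eval_sub, eval_X, eval_C, eval_mul]
    rw [hκ, hpc (-lam) m, ← prod_pow, ← prod_mul_distrib, ← prod_div_distrib]
    exact prod_congr rfl (fun k _ => by congr 1; ring)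
  · have h1 := aux_logder (univ.erase m) (fun k => U k * V k) (z m) (by
      intro k _
      simp only [U, V, eval_sub, eval_X, eval_C, eval_mul]
      exact mul_ne_zero (hd m k) (hd k m))
    have h2 := aux_logder (univ.erase m) (fun k => X - C (z k)) (z m) (by
      intro k hk
      simp only [eval_sub, eval_X, eval_C]
      exact hne m k hk)
    have h1' : (derivative (W m)).eval (z m) / (W m).eval (z m) = _ :=
      (div_eq_iff hw).mpr (h1.trans (mul_comm _ _))
    have h2' : (derivative (Q m)).eval (z m) / (Q m).eval (z m) = _ :=
      (div_eq_iff hq).mpr (h2.trans (mul_comm _ _))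
    rw [h1', h2', hu, mul_sum, ← sum_sub_distrib, mul_sum]
    refine sum_congr rfl (fun k hk => ?_)
    have a1 := hne m k hk
    have a2 := hd m k
    have a3 := hd k m
    simp only [U, V, derivative_mul, derivative_sub, derivative_X, derivative_C, eval_mul,
      eval_sub, eval_add, eval_X, eval_C, eval_one, eval_zero]
    have := aux_u (z m) (z k) lam a1 a2 a3
    linear_combination this
  · have := congrArg (eval (z m)) hSP
    rw [hQQ m] at this
    simp only [eval_mul, eval_sub, eval_add, eval_pow, eval_X, eval_C] at this
    linear_combination this
  · have := congrArg (fun p => eval (z m) (derivative p)) hSP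
    rw [hQQ m] at this
    simp only [derivative_mul, derivative_sub, derivative_add, derivative_X, derivative_C,
      derivative_pow, eval_mul, eval_sub, eval_add, eval_pow, eval_X, eval_C, eval_one,
      eval_zero] at this
    linear_combination this

/-- The Liouville-type functional identity
`∑_m t_{im} f_m² t_{mj} (t_{mj} - t_{im} + u_m) = ∑_m f_m² (t_{im} - t_{mj})`
proved in the paper via a contour integral. -/
theorem stmt_1 (N : ℕ) (z : Fin (2 * N + 1) → ℂ) (lam : ℂ)
    (hinj : Function.Injective z) (hz : ∀ i, z i ≠ 0) (hlam : lam ≠ 0)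
    (hzl : ∀ i j, z i ≠ lam * z j)
    (t : Fin (2 * N + 1) → Fin (2 * N + 1) → ℂ)
    (ht : ∀ i j, t i j = (z i + lam * z j) / (z i - lam * z j))
    (f2 : Fin (2 * N + 1) → ℂ)
    (hf2 : ∀ m, f2 m = ∏ k ∈ univ.erase m,
      ((z m - lam * z k) * (z k - lam * z m)) / (lam * (z m - z k) * (z k - z m)))
    (u : Fin (2 * N + 1) → ℂ)
    (hu : ∀ m, u m = ∑ k ∈ univ.erase m,
      (2 * (z m + z k) / (z m - z k) + (z k + lam * z m) / (z k - lam * z m)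
        - (z m + lam * z k) / (z m - lam * z k))) :
    ∀ i j, ∑ m, t i m * f2 m * t m j * (t m j - t i m + u m)
      = ∑ m, f2 m * (t i m - t m j) :=
  aux_main N z lam hinj hz hlam hzl t ht f2 hf2 u hu
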